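/- Let 1 ≤ p < ∞, let α ∈ [−1/2, 0], let β ≥ 0 be fixed, and let R > 0. Then for every measurable f : [0,∞) → ℝ that vanishes on (R, ∞) and satisfies ∫_0^R |f(t)|^p dt < ∞, one has lim_{n→∞} ∫_0^R | M_n^{(α,β)}[f](x) − f(x) |^p dx = 0, the limit being over natural numbers n > β. -/

import Mathlib

open MeasureTheory Real Filter

/-- The Szász–Mirakyan basis functions `ψ_{n,k}(x) = e^{-nx} (nx)^k / k!`. -/
noncomputable def psi (n k : ℕ) (x : ℝ) : ℝ :=
  Real.exp (-(n * x)) * (n * x) ^ k / (Nat.factorial k)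

/-- The Szász–Mirakyan–Laguerre–Durrmeyer operator `M_n^{(α,β)}`. -/
noncomputable def M (α β : ℝ) (n : ℕ) (f : ℝ → ℝ) (x : ℝ) : ℝ :=
  ∑' k : ℕ, (((n : ℝ) - β) ^ ((k : ℝ) + α + 1) / Real.Gamma ((k : ℝ) + α + 1)) *
    (∫ t in Set.Ioi (0 : ℝ), f t * t ^ ((k : ℝ) + α) * Real.exp (-((n : ℝ) - β) * t)) *
    psi n k x

/-- The `r`-th moment `μ_r^{(α,β)}(x) = M_n^{(α,β)}[t ↦ t^r](x)`. -/
noncomputable def mu (α β : ℝ) (n : ℕ) (r : ℕ) (x : ℝ) : ℝ :=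
  M α β n (fun t => t ^ r) x

/-- The Gamma density. -/
noncomputable def gam (s m t : ℝ) : ℝ := m ^ s / Real.Gamma s * t ^ (s - 1) * Real.exp (-(m * t))

lemma gam_nonneg {s m t : ℝ} (hs : 0 < s) (hm : 0 < m) (ht : 0 ≤ t) : 0 ≤ gam s m t := by
  unfold gam
  have := Real.Gamma_pos_of_pos hs
  positivity

lemma gam_measurable (s m : ℝ) : Measurable (gam s m) := by
  unfold gam
  fun_prop

lemma gam_integrable {s m : ℝ} (hs : 0 < s) (hm : 0 < m) :
    IntegrableOn (gam s m) (Set.Ioi 0) := by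
  have h := integrableOn_rpow_mul_exp_neg_mul_rpow (p := 1) (s := s - 1) (b := m) (by linarith)
    one_pos hm
  have h2 := h.const_mul (m ^ s / Real.Gamma s)
  refine h2.congr ?_
  filter_upwards with t
  simp only [gam, Real.rpow_one]
  ring_nf

lemma gam_integral {s m : ℝ} (hs : 0 < s) (hm : 0 < m) :
    ∫ t in Set.Ioi (0 : ℝ), gam s m t = 1 := by
  unfold gam
  simp_rw [mul_assoc]
  rw [integral_const_mul, Real.integral_rpow_mul_exp_neg_mul_Ioi hs hm, one_div,
    Real.inv_rpow hm.le]
  have := (Real.Gamma_pos_of_pos hs).ne'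
  have := (Real.rpow_pos_of_pos hm s).ne'
  field_simp

lemma gam_lintegral {s m : ℝ} (hs : 0 < s) (hm : 0 < m) :
    ∫⁻ t in Set.Ioi (0 : ℝ), ENNReal.ofReal (gam s m t) = 1 := by
  rw [← ofReal_integral_eq_lintegral_ofReal (gam_integrable hs hm), gam_integral hs hm]
  · simp
  · filter_upwards [ae_restrict_mem measurableSet_Ioi] with t ht
    exact gam_nonneg hs hm (le_of_lt ht)

lemma gam_succ {s m t : ℝ} (hs : 0 < s) (hm : 0 < m) (ht : 0 < t) :
    t * gam s m t = s / m * gam (s + 1) m t := by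
  unfold gam
  rw [Real.Gamma_add_one hs.ne', Real.rpow_add hm, Real.rpow_one,
    show s + 1 - 1 = (s - 1) + 1 by ring, Real.rpow_add ht, Real.rpow_one]
  have := (Real.Gamma_pos_of_pos hs).ne'
  field_simp

lemma gam_tel {s m t : ℝ} (hs : 0 < s) (hm : 0 < m) (ht : 0 < t) :
    gam (s + 1) m t = m * (∫ u in (0 : ℝ)..t, gam s m u) - m * (∫ u in (0 : ℝ)..t, gam (s + 1) m u) := by
  have hi : ∀ s : ℝ, 0 < s → IntervalIntegrable (gam s m) volume 0 t := by
    intro s hs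
    rw [intervalIntegrable_iff_integrableOn_Ioc_of_le ht.le]
    exact (gam_integrable hs hm).mono_set Set.Ioc_subset_Ioi_self
  have hc : ContinuousOn (gam (s + 1) m) (Set.Icc 0 t) := by
    unfold gam
    refine ContinuousOn.mul (ContinuousOn.mul continuousOn_const ?_) (by fun_prop)
    exact (continuous_id.rpow_const (fun x => Or.inr (by linarith))).continuousOn
  have h := intervalIntegral.integral_eq_sub_of_hasDerivAt_of_le (f := gam (s + 1) m)
    (f' := fun u => m * (gam s m u - gam (s + 1) m u)) ht.le hc ?_
    (((hi s hs).sub (hi (s + 1) (by linarith))).const_mul m)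
  · rw [intervalIntegral.integral_const_mul, intervalIntegral.integral_sub (hi s hs)
      (hi (s + 1) (by linarith))] at h
    have h0 : gam (s + 1) m 0 = 0 := by
      simp [gam, Real.zero_rpow hs.ne']
    rw [h0] at h
    linarith
  · intro u hu
    have hu0 : 0 < u := hu.1
    have h1 : HasDerivAt (fun u : ℝ => u ^ (s + 1 - 1)) ((s + 1 - 1) * u ^ (s + 1 - 1 - 1)) u :=
      Real.hasDerivAt_rpow_const (Or.inl hu0.ne')
    have h2 : HasDerivAt (fun u : ℝ => Real.exp (-(m * u))) (Real.exp (-(m * u)) * (-(m * 1))) u :=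
      (((hasDerivAt_id u).const_mul m).neg).exp
    have h3 := ((h1.const_mul (m ^ (s + 1) / Real.Gamma (s + 1))).mul h2)
    have h4 : gam (s + 1) m = (fun y => m ^ (s + 1) / Real.Gamma (s + 1) * y ^ (s + 1 - 1)) *
        fun u => Real.exp (-(m * u)) := by
      rfl
    rw [← h4] at h3
    refine h3.congr_deriv ?_
    unfold gam
    rw [Real.Gamma_add_one hs.ne', Real.rpow_add hm, Real.rpow_one,
      show s + 1 - 1 = s by ring]
    have := (Real.Gamma_pos_of_pos hs).ne'
    field_simp
    ring

lemma gam_sum {s m t : ℝ} (hs : 0 < s) (hm : 0 < m) (ht : 0 < t) (N : ℕ) :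
    ∑ k ∈ Finset.range N, gam (s + k + 1) m t =
      m * (∫ u in (0 : ℝ)..t, gam s m u) - m * (∫ u in (0 : ℝ)..t, gam (s + N) m u) := by
  induction N with
  | zero => simp
  | succ N ih =>
    rw [Finset.sum_range_succ, ih, gam_tel (by positivity) hm ht]
    push_cast
    rw [show s + (N + 1 : ℝ) = s + N + 1 by ring]
    ring

lemma gam_sum_le {s m t : ℝ} (hs : 0 < s) (hm : 0 < m) (ht : 0 < t) (N : ℕ) :
    ∑ k ∈ Finset.range N, gam (s + k + 1) m t ≤ m := by
  rw [gam_sum hs hm ht]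
  have h1 : ∫ u in (0 : ℝ)..t, gam s m u ≤ 1 := by
    rw [intervalIntegral.integral_of_le ht.le, ← gam_integral hs hm]
    refine setIntegral_mono_set (gam_integrable hs hm) ?_
      (Set.Ioc_subset_Ioi_self).eventuallyLE
    filter_upwards [ae_restrict_mem measurableSet_Ioi] with t ht
    exact gam_nonneg hs hm (le_of_lt ht)
  have h2 : 0 ≤ ∫ u in (0 : ℝ)..t, gam (s + N) m u :=
    intervalIntegral.integral_nonneg ht.le
      (fun u hu => gam_nonneg (by positivity) hm hu.1)
  nlinarith

lemma gam_le {s m t : ℝ} (hs : 0 < s) (hm : 0 < m) (ht : 0 < t) : gam (s + 1) m t ≤ m := by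
  simpa using gam_sum_le hs hm ht 1

lemma gam_tsum_le {s m t : ℝ} (hs : 0 < s) (hm : 0 < m) (ht : 0 < t) :
    ∑' k : ℕ, ENNReal.ofReal (gam (s + k + 1) m t) ≤ ENNReal.ofReal m := by
  rw [ENNReal.tsum_eq_iSup_nat]
  refine iSup_le fun N => ?_
  rw [← ENNReal.ofReal_sum_of_nonneg]
  · exact ENNReal.ofReal_le_ofReal (gam_sum_le hs hm ht N)
  · intro k _
    exact gam_nonneg (by positivity) hm ht.le

/-- moments of the Gamma density -/
lemma gam_sq_integral {s m : ℝ} (hs : 0 < s) (hm : 0 < m) (x : ℝ) :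
    IntegrableOn (fun t => (t - x) ^ 2 * gam s m t) (Set.Ioi 0) ∧
    ∫ t in Set.Ioi (0 : ℝ), (t - x) ^ 2 * gam s m t
      = s * (s + 1) / m ^ 2 - 2 * x * (s / m) + x ^ 2 := by
  have he : Set.EqOn (fun t => (t - x) ^ 2 * gam s m t) (fun t => (s * (s + 1) / m ^ 2) * gam (s + 1 + 1) m t
      - (2 * x * (s / m)) * gam (s + 1) m t + x ^ 2 * gam s m t) (Set.Ioi 0) := by
    intro t ht
    have h1 := gam_succ hs hm ht
    have h2 := gam_succ (s := s + 1) (by linarith) hm ht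
    have : (t - x) ^ 2 * gam s m t = t * (t * gam s m t) - 2 * x * (t * gam s m t)
      + x ^ 2 * gam s m t := by ring
    simp only
    rw [this, h1, mul_left_comm, h2]
    field_simp
  have i1 := (gam_integrable hs hm).const_mul (x ^ 2)
  have i2 := (gam_integrable (s := s + 1) (by linarith) hm).const_mul (2 * x * (s / m))
  have i3 := (gam_integrable (s := s + 1 + 1) (by linarith) hm).const_mul (s * (s + 1) / m ^ 2)
  constructor
  · exact IntegrableOn.congr_fun ((i3.sub i2).add i1) he.symm measurableSet_Ioi
  · rw [setIntegral_congr_fun measurableSet_Ioi he, integral_add (by exact i3.sub i2) i1,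
      integral_sub i3 i2, integral_const_mul, integral_const_mul, integral_const_mul,
      gam_integral hs hm, gam_integral (by linarith) hm, gam_integral (by linarith) hm]
    ring

lemma psi_nonneg (n k : ℕ) {x : ℝ} (hx : 0 ≤ x) : 0 ≤ psi n k x := by
  unfold psi; positivity

lemma psi_measurable (n k : ℕ) : Measurable (psi n k) := by
  unfold psi; fun_prop

lemma psi_hasSum (n : ℕ) (x : ℝ) : HasSum (fun k => psi n k x) 1 := by
  have h := NormedSpace.expSeries_div_hasSum_exp (n * x : ℝ)
  rw [← Real.exp_eq_exp_ℝ] at h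
  have := h.mul_left (Real.exp (-(n * x)))
  rw [← Real.exp_add, neg_add_cancel, Real.exp_zero] at this
  simpa only [psi, mul_div_assoc] using this

lemma psi_succ (n k : ℕ) (x : ℝ) : ((k + 1 : ℕ) : ℝ) * psi n (k + 1) x = n * x * psi n k x := by
  unfold psi
  rw [Nat.factorial_succ]
  have : (Nat.factorial k : ℝ) ≠ 0 := by positivity
  push_cast
  field_simp
  ring

lemma psi_hasSum1 (n : ℕ) (x : ℝ) : HasSum (fun k : ℕ => (k : ℝ) * psi n k x) (n * x) := by
  rw [← hasSum_nat_add_iff' 1]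
  simp only [psi_succ]
  simpa using (psi_hasSum n x).mul_left (n * x)

lemma psi_hasSum2 (n : ℕ) (x : ℝ) :
    HasSum (fun k : ℕ => (k : ℝ) ^ 2 * psi n k x) (n * x * (n * x + 1)) := by
  rw [← hasSum_nat_add_iff' 1]
  have : ∀ k : ℕ, ((k + 1 : ℕ) : ℝ) ^ 2 * psi n (k + 1) x = n * x * (k * psi n k x + psi n k x) := by
    intro k
    rw [sq, mul_assoc, psi_succ]; push_cast; ring
  simp only [this]
  simpa using ((psi_hasSum1 n x).add (psi_hasSum n x)).mul_left (n * x)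

lemma psi_lintegral (n k : ℕ) (hn : 0 < n) :
    ∫⁻ x in Set.Ioi (0 : ℝ), ENNReal.ofReal (psi n k x) = ENNReal.ofReal (1 / n) := by
  have hn' : (0 : ℝ) < n := by exact_mod_cast hn
  have : ∀ x : ℝ, psi n k x = 1 / n * gam (k + 1) n x := by
    intro x
    unfold psi gam
    rw [Real.Gamma_nat_eq_factorial, add_sub_cancel_right, Real.rpow_natCast, mul_pow,
      Real.rpow_add hn', Real.rpow_one, Real.rpow_natCast]
    field_simp
  simp_rw [this, ENNReal.ofReal_mul (by positivity : (0 : ℝ) ≤ 1 / n)]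
  rw [lintegral_const_mul _ (gam_measurable _ _).ennreal_ofReal, gam_lintegral (by positivity) hn',
    mul_one]

/-- Coefficients of the operator. -/
noncomputable def Ac (α m : ℝ) (k : ℕ) (h : ℝ → ℝ) : ℝ :=
  ∫ t in Set.Ioi (0 : ℝ), h t * gam ((k : ℝ) + α + 1) m t

/-- The operator without the term `k = 0`. -/
noncomputable def Sop (α m : ℝ) (n : ℕ) (h : ℝ → ℝ) (x : ℝ) : ℝ :=
  ∑' k : ℕ, Ac α m (k + 1) h * psi n (k + 1) x

lemma idx (α : ℝ) (k : ℕ) : ((k + 1 : ℕ) : ℝ) + α + 1 = (α + 1) + k + 1 := by push_cast; ring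

lemma Ac_integrable {α m : ℝ} (hα : 0 < α + 1) (hm : 0 < m) (k : ℕ) {h : ℝ → ℝ}
    (hh : IntegrableOn h (Set.Ioi 0)) :
    IntegrableOn (fun t => h t * gam (((k + 1 : ℕ) : ℝ) + α + 1) m t) (Set.Ioi 0) := by
  rw [idx]
  refine Integrable.mono' (hh.norm.const_mul m)
    (hh.aestronglyMeasurable.mul (gam_measurable _ _).aestronglyMeasurable) ?_
  filter_upwards [ae_restrict_mem measurableSet_Ioi] with t ht
  rw [norm_mul, mul_comm m]
  have h0 : 0 ≤ gam (α + 1 + k + 1) m t := gam_nonneg (by positivity) hm (le_of_lt ht)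
  rw [Real.norm_of_nonneg h0]
  exact mul_le_mul_of_nonneg_left (gam_le (by positivity) hm ht) (norm_nonneg _)

lemma Ac_bound {α m : ℝ} (hα : 0 < α + 1) (hm : 0 < m) (k : ℕ) {h : ℝ → ℝ}
    (hh : IntegrableOn h (Set.Ioi 0)) :
    |Ac α m (k + 1) h| ≤ m * ∫ t in Set.Ioi (0 : ℝ), ‖h t‖ := by
  unfold Ac
  rw [← Real.norm_eq_abs, ← integral_const_mul]
  refine norm_integral_le_of_norm_le (hh.norm.const_mul m) ?_
  filter_upwards [ae_restrict_mem measurableSet_Ioi] with t ht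
  rw [idx, norm_mul, mul_comm m]
  have h0 : 0 ≤ gam (α + 1 + k + 1) m t := gam_nonneg (by positivity) hm (le_of_lt ht)
  rw [Real.norm_of_nonneg h0]
  exact mul_le_mul_of_nonneg_left (gam_le (by positivity) hm ht) (norm_nonneg _)

lemma Sop_summable {α m : ℝ} (hα : 0 < α + 1) (hm : 0 < m) (n : ℕ) {h : ℝ → ℝ}
    (hh : IntegrableOn h (Set.Ioi 0)) {x : ℝ} (hx : 0 ≤ x) :
    Summable (fun k : ℕ => Ac α m (k + 1) h * psi n (k + 1) x) := by
  have h1 : Summable (fun k : ℕ => psi n (k + 1) x) :=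
    (summable_nat_add_iff 1).2 (psi_hasSum n x).summable
  refine Summable.of_norm_bounded (h1.mul_left (m * ∫ t in Set.Ioi (0 : ℝ), ‖h t‖)) ?_
  intro k
  rw [norm_mul, Real.norm_of_nonneg (psi_nonneg n (k + 1) hx)]
  exact mul_le_mul_of_nonneg_right (Ac_bound hα hm k hh) (psi_nonneg n (k + 1) hx)

lemma Sop_measurable (α m : ℝ) (n : ℕ) (h : ℝ → ℝ) : Measurable (Sop α m n h) := by
  unfold Sop
  exact Measurable.tsum (fun k => (psi_measurable n (k + 1)).const_mul _)

lemma Sop_sub {α m : ℝ} (hα : 0 < α + 1) (hm : 0 < m) (n : ℕ) {f g : ℝ → ℝ}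
    (hf : IntegrableOn f (Set.Ioi 0)) (hg : IntegrableOn g (Set.Ioi 0)) {x : ℝ} (hx : 0 ≤ x) :
    Sop α m n (f - g) x = Sop α m n f x - Sop α m n g x := by
  unfold Sop
  rw [← Summable.tsum_sub (Sop_summable hα hm n hf hx) (Sop_summable hα hm n hg hx)]
  congr 1
  ext k
  rw [← sub_mul]
  congr 1
  unfold Ac
  rw [← integral_sub (Ac_integrable hα hm k hf) (Ac_integrable hα hm k hg)]
  congr 1
  ext t
  simp [sub_mul]

lemma M_eq {α β : ℝ} (hα : 0 < α + 1) (n : ℕ) (hn : β < n) {f : ℝ → ℝ}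
    (hf : IntegrableOn f (Set.Ioi 0)) {x : ℝ} (hx : 0 ≤ x) :
    M α β n f x = Ac α (n - β) 0 f * psi n 0 x + Sop α (n - β) n f x := by
  have hm : 0 < (n : ℝ) - β := by linarith
  have h1 : ∀ k : ℕ, (((n : ℝ) - β) ^ ((k : ℝ) + α + 1) / Real.Gamma ((k : ℝ) + α + 1)) *
    (∫ t in Set.Ioi (0 : ℝ), f t * t ^ ((k : ℝ) + α) * Real.exp (-((n : ℝ) - β) * t)) =
      Ac α (n - β) k f := by
    intro k
    unfold Ac gam
    rw [← integral_const_mul]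
    refine integral_congr_ae (Eventually.of_forall fun t => ?_)
    simp only
    rw [add_sub_cancel_right, neg_mul]
    ring
  unfold M
  simp_rw [h1]
  have h2 : Summable (fun k : ℕ => Ac α (n - β) k f * psi n k x) :=
    (summable_nat_add_iff (f := fun k : ℕ => Ac α (n - β) k f * psi n k x) 1).1
      (Sop_summable hα hm n hf hx)
  rw [h2.tsum_eq_zero_add, Sop]

/-- The kernel of `Sop`. -/
noncomputable def Ker (α m : ℝ) (n : ℕ) (x t : ℝ) : ENNReal :=
  ∑' k : ℕ, ENNReal.ofReal (psi n (k + 1) x) * ENNReal.ofReal (gam (((k + 1 : ℕ) : ℝ) + α + 1) m t)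

lemma Ker_measurable (α m : ℝ) (n : ℕ) : Measurable (Function.uncurry (Ker α m n)) := by
  unfold Ker Function.uncurry
  refine Measurable.tsum fun k => ?_
  exact (((psi_measurable n (k + 1)).comp measurable_fst).ennreal_ofReal).mul
    (((gam_measurable _ m).comp measurable_snd).ennreal_ofReal)

lemma Ker_int_t {α m : ℝ} (hα : 0 < α + 1) (hm : 0 < m) (n : ℕ) {x : ℝ} (hx : 0 ≤ x) :
    ∫⁻ t in Set.Ioi (0 : ℝ), Ker α m n x t ≤ 1 := by
  unfold Ker
  rw [lintegral_tsum (fun k => ((gam_measurable _ m).ennreal_ofReal.const_mul _).aemeasurable)]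
  have : ∀ k : ℕ, ∫⁻ t in Set.Ioi (0 : ℝ), ENNReal.ofReal (psi n (k + 1) x) *
      ENNReal.ofReal (gam (((k + 1 : ℕ) : ℝ) + α + 1) m t) = ENNReal.ofReal (psi n (k + 1) x) := by
    intro k
    rw [lintegral_const_mul _ (gam_measurable _ m).ennreal_ofReal, idx,
      gam_lintegral (by positivity) hm, mul_one]
  simp_rw [this]
  have h2 : ∑' k : ℕ, ENNReal.ofReal (psi n k x) = 1 := by
    rw [← ENNReal.ofReal_tsum_of_nonneg (fun k => psi_nonneg n k hx) (psi_hasSum n x).summable,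
      (psi_hasSum n x).tsum_eq, ENNReal.ofReal_one]
  rw [← h2]
  exact ENNReal.tsum_comp_le_tsum_of_injective (add_left_injective 1)
    (fun k => ENNReal.ofReal (psi n k x))

lemma Ker_int_x {α m : ℝ} (hα : 0 < α + 1) (hm : 0 < m) (n : ℕ) (hmn : m ≤ n) {t : ℝ} (ht : 0 < t) :
    ∫⁻ x in Set.Ioi (0 : ℝ), Ker α m n x t ≤ 1 := by
  have hn : (0 : ℝ) < n := by linarith
  unfold Ker
  rw [lintegral_tsum (fun k => ((psi_measurable _ _).ennreal_ofReal.mul_const _).aemeasurable)]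
  have : ∀ k : ℕ, ∫⁻ x in Set.Ioi (0 : ℝ), ENNReal.ofReal (psi n (k + 1) x) *
      ENNReal.ofReal (gam (((k + 1 : ℕ) : ℝ) + α + 1) m t) =
      ENNReal.ofReal (1 / n) * ENNReal.ofReal (gam (α + 1 + k + 1) m t) := by
    intro k
    rw [lintegral_mul_const _ (psi_measurable _ _).ennreal_ofReal, idx,
      psi_lintegral _ _ (by exact_mod_cast hn)]
  simp_rw [this]
  rw [ENNReal.tsum_mul_left]
  calc _ ≤ ENNReal.ofReal (1 / n) * ENNReal.ofReal m := by
        gcongr; exact gam_tsum_le hα hm ht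
    _ = ENNReal.ofReal (1 / n * m) := (ENNReal.ofReal_mul (by positivity)).symm
    _ ≤ 1 := by
        rw [ENNReal.ofReal_le_one]
        rw [one_div, inv_mul_le_iff₀ hn]; linarith

lemma Sop_le_Ker {α m : ℝ} (hα : 0 < α + 1) (hm : 0 < m) (n : ℕ) {h : ℝ → ℝ}
    (hh : Measurable h) {x : ℝ} (hx : 0 ≤ x) :
    ‖Sop α m n h x‖ₑ ≤ ∫⁻ t in Set.Ioi (0 : ℝ), Ker α m n x t * ‖h t‖ₑ := by
  unfold Sop
  refine enorm_tsum_le_tsum_enorm.trans ?_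
  unfold Ker
  simp_rw [← ENNReal.tsum_mul_right]
  rw [lintegral_tsum (fun k => by exact (((gam_measurable _ m).ennreal_ofReal.const_mul _).mul
    hh.enorm).aemeasurable)]
  refine ENNReal.tsum_le_tsum fun k => ?_
  simp_rw [mul_assoc]
  rw [lintegral_const_mul _ (by exact (gam_measurable _ m).ennreal_ofReal.mul hh.enorm), enorm_mul, mul_comm,
    Real.enorm_of_nonneg (psi_nonneg n (k + 1) hx)]
  gcongr
  unfold Ac
  refine (enorm_integral_le_lintegral_enorm _).trans ?_
  refine setLIntegral_mono' measurableSet_Ioi fun t ht => ?_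
  rw [enorm_mul, mul_comm, Real.enorm_of_nonneg]
  rw [idx]
  exact gam_nonneg (by positivity) hm (le_of_lt ht)

lemma Sop_contr {α m : ℝ} (hα : 0 < α + 1) (hm : 0 < m) (n : ℕ) (hmn : m ≤ n) {h : ℝ → ℝ}
    (hh : Measurable h) {p : ℝ} (hp : 1 ≤ p) :
    ∫⁻ x in Set.Ioi (0 : ℝ), ‖Sop α m n h x‖ₑ ^ p ≤ ∫⁻ t in Set.Ioi (0 : ℝ), ‖h t‖ₑ ^ p := by
  have hp0 : 0 < p := by linarith
  have key : ∀ x : ℝ, 0 < x → ‖Sop α m n h x‖ₑ ^ p ≤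
      ∫⁻ t in Set.Ioi (0 : ℝ), Ker α m n x t * ‖h t‖ₑ ^ p := by
    intro x hx
    have hK : Measurable (Ker α m n x) := (Ker_measurable α m n).of_uncurry_left
    set ν := (volume.restrict (Set.Ioi (0 : ℝ))).withDensity (Ker α m n x) with hν
    have hν1 : ν Set.univ ≤ 1 := by
      rw [hν, withDensity_apply _ MeasurableSet.univ, Measure.restrict_univ]
      exact Ker_int_t hα hm n hx.le
    have h1 := eLpNorm_le_eLpNorm_mul_rpow_measure_univ (μ := ν) (f := h) (p := 1)
      (q := ENNReal.ofReal p) (by simpa using hp) hh.aestronglyMeasurable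
    have h2 : eLpNorm h 1 ν ≤ eLpNorm h (ENNReal.ofReal p) ν := by
      refine h1.trans ?_
      calc _ ≤ eLpNorm h (ENNReal.ofReal p) ν * 1 := by
            gcongr
            refine ENNReal.rpow_le_one hν1 ?_
            rw [ENNReal.toReal_ofReal hp0.le]
            simp only [ENNReal.toReal_one, one_div, inv_one, sub_nonneg]
            exact inv_le_one_of_one_le₀ hp
        _ = _ := mul_one _
    rw [eLpNorm_one_eq_lintegral_enorm, eLpNorm_eq_lintegral_rpow_enorm_toReal
      (by simpa using hp0) ENNReal.ofReal_ne_top, ENNReal.toReal_ofReal hp0.le,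
      lintegral_withDensity_eq_lintegral_mul _ hK hh.enorm,
      lintegral_withDensity_eq_lintegral_mul _ hK (hh.enorm.pow_const p)] at h2
    have h3 := ENNReal.rpow_le_rpow ((Sop_le_Ker hα hm n hh hx.le).trans h2) hp0.le
    rw [← ENNReal.rpow_mul, one_div, inv_mul_cancel₀ hp0.ne', ENNReal.rpow_one] at h3
    exact h3
  calc ∫⁻ x in Set.Ioi (0 : ℝ), ‖Sop α m n h x‖ₑ ^ p
      ≤ ∫⁻ x in Set.Ioi (0 : ℝ), ∫⁻ t in Set.Ioi (0 : ℝ), Ker α m n x t * ‖h t‖ₑ ^ p :=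
        setLIntegral_mono' measurableSet_Ioi fun x hx => key x hx
    _ = ∫⁻ t in Set.Ioi (0 : ℝ), ∫⁻ x in Set.Ioi (0 : ℝ), Ker α m n x t * ‖h t‖ₑ ^ p := by
        refine lintegral_lintegral_swap ?_
        exact ((Ker_measurable α m n).mul
          ((hh.enorm.pow_const p).comp measurable_snd)).aemeasurable
    _ ≤ _ := by
        refine setLIntegral_mono' measurableSet_Ioi fun t ht => ?_
        rw [lintegral_mul_const _ (Ker_measurable α m n).of_uncurry_right]
        calc _ ≤ 1 * ‖h t‖ₑ ^ p := by gcongr; exact Ker_int_x hα hm n hmn ht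
          _ = _ := one_mul _

lemma Sop_bdd {α m : ℝ} (hα : 0 < α + 1) (hm : 0 < m) (n : ℕ) {h : ℝ → ℝ}
    (hh : Measurable h) {B : ℝ} (hB : ∀ t, ‖h t‖ ≤ B) {x : ℝ} (hx : 0 ≤ x) :
    ‖Sop α m n h x‖ₑ ≤ ENNReal.ofReal B := by
  refine (Sop_le_Ker hα hm n hh hx).trans ?_
  have hK : Measurable (Ker α m n x) := (Ker_measurable α m n).of_uncurry_left
  calc _ ≤ ∫⁻ t in Set.Ioi (0 : ℝ), Ker α m n x t * ENNReal.ofReal B := by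
        gcongr with t
        rw [← ofReal_norm]
        exact ENNReal.ofReal_le_ofReal (hB t)
    _ = (∫⁻ t in Set.Ioi (0 : ℝ), Ker α m n x t) * ENNReal.ofReal B :=
        lintegral_mul_const _ hK
    _ ≤ 1 * ENNReal.ofReal B := by gcongr; exact Ker_int_t hα hm n hx
    _ = _ := one_mul _

/-- second central moment of a coefficient -/
noncomputable def Qc (α m x : ℝ) (k : ℕ) : ℝ :=
  ((k : ℝ) + α + 1) * ((k : ℝ) + α + 1 + 1) / m ^ 2 - 2 * x * (((k : ℝ) + α + 1) / m) + x ^ 2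

/-- second central moment of the operator -/
noncomputable def Vc (α m x : ℝ) (n : ℕ) : ℝ :=
  (n * x * (n * x + 1) + (2 * α + 3) * (n * x) + (α + 1) * (α + 2)) / m ^ 2
    - 2 * x * ((n * x + (α + 1)) / m) + x ^ 2

lemma Qc_hasSum {α m : ℝ} (hm : 0 < m) (n : ℕ) (x : ℝ) :
    HasSum (fun k => psi n k x * Qc α m x k) (Vc α m x n) := by
  have h0 := psi_hasSum n x
  have h1 := psi_hasSum1 n x
  have h2 := psi_hasSum2 n x
  have h := ((h2.mul_left (1 / m ^ 2)).add (h1.mul_left ((2 * α + 3) / m ^ 2 - 2 * x / m))).add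
    (h0.mul_left ((α + 1) * (α + 2) / m ^ 2 - 2 * x * ((α + 1) / m) + x ^ 2))
  have hv : Vc α m x n = 1 / m ^ 2 * (n * x * (n * x + 1)) +
      ((2 * α + 3) / m ^ 2 - 2 * x / m) * (n * x) +
      ((α + 1) * (α + 2) / m ^ 2 - 2 * x * ((α + 1) / m) + x ^ 2) * 1 := by
    unfold Vc
    field_simp
    ring
  rw [hv]
  refine Eq.mpr (congrArg (fun F => HasSum F _) (funext fun k => ?_)) h
  unfold Qc
  field_simp
  ring

lemma Ac_sub_le {α m : ℝ} (hα : 0 < α + 1) (hm : 0 < m) (k : ℕ) {g : ℝ → ℝ}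
    (hg : IntegrableOn g (Set.Ioi 0)) {x e C : ℝ}
    (hgx : ∀ t, |g t - g x| ≤ e + C * (t - x) ^ 2) :
    |Ac α m (k + 1) g - g x| ≤ e + C * Qc α m x (k + 1) := by
  have hs : 0 < ((k + 1 : ℕ) : ℝ) + α + 1 := by rw [idx]; positivity
  have hi := gam_integrable hs hm
  obtain ⟨q1, q2⟩ := gam_sq_integral hs hm x
  have e1 : Ac α m (k + 1) g - g x =
      ∫ t in Set.Ioi (0 : ℝ), (g t - g x) * gam (((k + 1 : ℕ) : ℝ) + α + 1) m t := by
    simp_rw [sub_mul]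
    rw [integral_sub (Ac_integrable hα hm k hg) (hi.const_mul _), integral_const_mul,
      gam_integral hs hm, mul_one]
    rfl
  have e2 : e + C * Qc α m x (k + 1) =
      ∫ t in Set.Ioi (0 : ℝ), (e * gam (((k + 1 : ℕ) : ℝ) + α + 1) m t +
        C * ((t - x) ^ 2 * gam (((k + 1 : ℕ) : ℝ) + α + 1) m t)) := by
    rw [integral_add (hi.const_mul _) (q1.const_mul _), integral_const_mul, integral_const_mul,
      gam_integral hs hm, q2, mul_one]
    rfl
  rw [e1, e2, ← Real.norm_eq_abs]
  refine norm_integral_le_of_norm_le ((hi.const_mul _).add (q1.const_mul _)) ?_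
  filter_upwards [ae_restrict_mem measurableSet_Ioi] with t ht
  have h0 := gam_nonneg hs hm (le_of_lt ht)
  rw [norm_mul, Real.norm_of_nonneg h0, Real.norm_eq_abs]
  calc _ ≤ (e + C * (t - x) ^ 2) * gam (((k + 1 : ℕ) : ℝ) + α + 1) m t :=
        mul_le_mul_of_nonneg_right (hgx t) h0
    _ = _ := by ring

lemma Sop_sub_le {α m : ℝ} (hα : 0 < α + 1) (hm : 0 < m) (n : ℕ) {g : ℝ → ℝ}
    (hg : IntegrableOn g (Set.Ioi 0)) {x e C : ℝ} (hx : 0 ≤ x) (he : 0 ≤ e) (hC : 0 ≤ C)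
    (hgx : ∀ t, |g t - g x| ≤ e + C * (t - x) ^ 2) :
    |Sop α m n g x - g x| ≤ e + C * Vc α m x n + Real.exp (-(n * x)) * |g x| := by
  have p1 : HasSum (fun k => psi n (k + 1) x) (1 - psi n 0 x) := by
    have := (hasSum_nat_add_iff' (f := fun k => psi n k x) 1).2 (psi_hasSum n x)
    simpa using this
  have hp0 : psi n 0 x = Real.exp (-(n * x)) := by simp [psi]
  have s1 : Sop α m n g x - g x = (∑' k : ℕ, (Ac α m (k + 1) g - g x) * psi n (k + 1) x)
      - psi n 0 x * g x := by
    simp_rw [sub_mul]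
    rw [Summable.tsum_sub (Sop_summable hα hm n hg hx) (p1.summable.mul_left _), tsum_mul_left,
      p1.tsum_eq, Sop]
    ring
  have hw : HasSum (fun k => psi n k x * (e + C * Qc α m x k)) (e + C * Vc α m x n) := by
    have := ((psi_hasSum n x).mul_left e).add ((Qc_hasSum (α := α) hm n x).mul_left C)
    rw [mul_one] at this
    exact Eq.mpr (congrArg (fun F => HasSum F _) (funext fun k => by ring)) this
  have hQ : ∀ k, 0 ≤ Qc α m x k := by
    intro k
    have hs : 0 < (k : ℝ) + α + 1 := by
      rw [add_assoc]; positivity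
    have := (gam_sq_integral hs hm x).2
    unfold Qc
    rw [← this]
    refine setIntegral_nonneg measurableSet_Ioi fun t ht => ?_
    have := gam_nonneg hs hm (le_of_lt ht)
    positivity
  have hw1 : Summable (fun k => psi n (k + 1) x * (e + C * Qc α m x (k + 1))) :=
    (summable_nat_add_iff (f := fun k => psi n k x * (e + C * Qc α m x k)) 1).2 hw.summable
  have hw2 : ∑' k, psi n (k + 1) x * (e + C * Qc α m x (k + 1)) ≤ e + C * Vc α m x n := by
    rw [← hw.tsum_eq, hw.summable.tsum_eq_zero_add]
    have : 0 ≤ psi n 0 x * (e + C * Qc α m x 0) :=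
      mul_nonneg (psi_nonneg n 0 hx) (add_nonneg he (mul_nonneg hC (hQ 0)))
    linarith
  have h3 : ‖∑' k : ℕ, (Ac α m (k + 1) g - g x) * psi n (k + 1) x‖ ≤
      ∑' k, psi n (k + 1) x * (e + C * Qc α m x (k + 1)) := by
    refine tsum_of_norm_bounded hw1.hasSum fun k => ?_
    rw [norm_mul, Real.norm_of_nonneg (psi_nonneg n (k + 1) hx), mul_comm, Real.norm_eq_abs]
    exact mul_le_mul_of_nonneg_left (Ac_sub_le hα hm k hg hgx) (psi_nonneg n (k + 1) hx)
  rw [s1, ← hp0]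
  calc _ ≤ |∑' k : ℕ, (Ac α m (k + 1) g - g x) * psi n (k + 1) x| + |psi n 0 x * g x| :=
        abs_sub _ _
    _ ≤ _ := by
        rw [abs_mul, abs_of_nonneg (psi_nonneg n 0 hx)]
        rw [Real.norm_eq_abs] at h3
        linarith

lemma tend_inv (β : ℝ) : Tendsto (fun n : ℕ => 1 / ((n : ℝ) - β)) atTop (nhds 0) := by
  have : Tendsto (fun n : ℕ => (n : ℝ) - β) atTop atTop :=
    tendsto_atTop_add_const_right _ _ tendsto_natCast_atTop_atTop
  simp only [one_div]
  exact this.inv_tendsto_atTop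

lemma ev_gt (β : ℝ) : ∀ᶠ n : ℕ in atTop, β < n := by
  exact tendsto_natCast_atTop_atTop.eventually_gt_atTop β

lemma Vc_tendsto (α β x : ℝ) : Tendsto (fun n : ℕ => Vc α (n - β) x n) atTop (nhds 0) := by
  have h0 := tend_inv β
  have h := ((((((h0.const_mul β).const_add 1).pow 2).mul_const (x ^ 2)).add
    ((((h0.const_mul β).const_add 1).mul h0).mul_const (x * (2 * α + 4)))).add
    ((h0.pow 2).mul_const ((α + 1) * (α + 2)))).sub
    ((((h0.const_mul β).const_add 1).mul_const (2 * x ^ 2)).add (h0.mul_const (2 * x * (α + 1))))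
  have h' := h.add_const (x ^ 2)
  have e : (1 + β * 0) ^ 2 * x ^ 2 + (1 + β * 0) * 0 * (x * (2 * α + 4)) +
      0 ^ 2 * ((α + 1) * (α + 2)) - ((1 + β * 0) * (2 * x ^ 2) + 0 * (2 * x * (α + 1))) + x ^ 2 = 0 := by
    ring
  rw [e] at h'
  refine h'.congr' ?_
  filter_upwards [ev_gt β] with n hn
  have : (n : ℝ) - β ≠ 0 := ne_of_gt (sub_pos.2 hn)
  unfold Vc
  field_simp
  ring

lemma Sop_tendsto {α : ℝ} (hα : 0 < α + 1) (β : ℝ) {g : ℝ → ℝ}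
    (hg : IntegrableOn g (Set.Ioi 0)) (hc : Continuous g) {B : ℝ} (hB : ∀ t, ‖g t‖ ≤ B)
    {x : ℝ} (hx : 0 < x) :
    Tendsto (fun n : ℕ => Sop α (n - β) n g x) atTop (nhds (g x)) := by
  have hB0 : 0 ≤ B := (norm_nonneg _).trans (hB 0)
  rw [Metric.tendsto_atTop']
  intro e he
  obtain ⟨δ, hδ, hd⟩ := Metric.continuous_iff.1 hc x (e / 2) (by positivity)
  set C := 2 * B / δ ^ 2 with hC
  have hC0 : 0 ≤ C := by positivity
  have hgx : ∀ t, |g t - g x| ≤ e / 2 + C * (t - x) ^ 2 := by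
    intro t
    by_cases h : dist t x < δ
    · have := hd t h
      rw [Real.dist_eq] at this
      nlinarith [mul_nonneg hC0 (sq_nonneg (t - x))]
    · have h1 : δ ≤ |t - x| := by rw [← Real.dist_eq]; exact not_lt.1 h
      have h2 : δ ^ 2 ≤ (t - x) ^ 2 := by
        rw [← sq_abs (t - x)]; gcongr
      have h3 : C * δ ^ 2 = 2 * B := by rw [hC]; field_simp
      have h4 : |g t - g x| ≤ 2 * B := by
        have := abs_sub (g t) (g x)
        have a1 := hB t
        have a2 := hB x
        rw [Real.norm_eq_abs] at a1 a2
        linarith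
      nlinarith [mul_le_mul_of_nonneg_left h2 hC0]
  have hexp : Tendsto (fun n : ℕ => Real.exp (-(n * x))) atTop (nhds 0) := by
    refine Real.tendsto_exp_neg_atTop_nhds_zero.comp ?_
    exact tendsto_natCast_atTop_atTop.atTop_mul_const hx
  have hl : Tendsto (fun n : ℕ => e / 2 + C * Vc α (n - β) x n + Real.exp (-(n * x)) * |g x|)
      atTop (nhds (e / 2 + C * 0 + 0 * |g x|)) :=
    (((Vc_tendsto α β x).const_mul C).const_add _).add (hexp.mul_const _)
  have hev := hl.eventually_lt_const (u := e) (by linarith)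
  obtain ⟨N, hN⟩ := eventually_atTop.1 (hev.and (ev_gt β))
  refine ⟨N, fun n hn => ?_⟩
  obtain ⟨h1, h2⟩ := hN n hn.le
  rw [Real.dist_eq]
  exact (Sop_sub_le hα (sub_pos.2 h2) n hg hx.le (by positivity) hC0 hgx).trans_lt h1

lemma Sop_Lp_tendsto {α : ℝ} (hα : 0 < α + 1) (β : ℝ) {g : ℝ → ℝ}
    (hg : IntegrableOn g (Set.Ioi 0)) (hc : Continuous g) {B : ℝ} (hB : ∀ t, ‖g t‖ ≤ B)
    (R : ℝ) {p : ℝ} (hp : 1 ≤ p) :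
    Tendsto (fun n : ℕ => ∫⁻ x in Set.Ioc 0 R, ‖Sop α (n - β) n g x - g x‖ₑ ^ p) atTop (nhds 0) := by
  have hp0 : 0 < p := by linarith
  rw [← lintegral_zero (μ := volume.restrict (Set.Ioc 0 R))]
  refine tendsto_lintegral_filter_of_dominated_convergence
    (fun _ => (ENNReal.ofReal B + ENNReal.ofReal B) ^ p) ?_ ?_ ?_ ?_
  · exact Eventually.of_forall fun n =>
      ((Sop_measurable _ _ _ _).sub hc.measurable).enorm.pow_const p
  · filter_upwards [ev_gt β] with n hn
    filter_upwards [ae_restrict_mem measurableSet_Ioc] with x hx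
    gcongr
    refine (enorm_sub_le).trans ?_
    gcongr
    · exact Sop_bdd hα (sub_pos.2 hn) n hc.measurable hB hx.1.le
    · rw [← ofReal_norm]
      exact ENNReal.ofReal_le_ofReal (hB x)
  · rw [lintegral_const]
    refine ENNReal.mul_ne_top (ENNReal.rpow_ne_top_of_nonneg hp0.le (by simp)) ?_
    simp
  · filter_upwards [ae_restrict_mem measurableSet_Ioc] with x hx
    have h1 := (Sop_tendsto hα β hg hc hB hx.1).sub_const (g x)
    rw [sub_self] at h1
    have h2 := ((ENNReal.continuous_rpow_const (y := p)).tendsto _).comp h1.enorm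
    rw [enorm_zero, ENNReal.zero_rpow_of_pos hp0] at h2
    exact h2

lemma dct_exp (β : ℝ) {c : ℝ} (hc : 0 < c) {F : ℝ → ENNReal} (hF : Measurable F)
    (hfin : ∫⁻ t in Set.Ioi (0 : ℝ), F t ≠ ⊤) :
    Tendsto (fun n : ℕ => ∫⁻ t in Set.Ioi (0 : ℝ), F t * ENNReal.ofReal (Real.exp (-(c * (n - β) * t))))
      atTop (nhds 0) := by
  rw [← lintegral_zero (μ := volume.restrict (Set.Ioi (0 : ℝ)))]
  refine tendsto_lintegral_filter_of_dominated_convergence F ?_ ?_ hfin ?_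
  · exact Eventually.of_forall fun n => hF.mul (by fun_prop)
  · filter_upwards [ev_gt β] with n hn
    filter_upwards [ae_restrict_mem measurableSet_Ioi] with t ht
    calc _ ≤ F t * 1 := by
          gcongr
          rw [ENNReal.ofReal_le_one, Real.exp_le_one_iff]
          have : 0 < c * (n - β) * t := mul_pos (mul_pos hc (sub_pos.2 hn)) ht
          linarith
      _ = _ := mul_one _
  · filter_upwards [ae_restrict_mem measurableSet_Ioi, ae_lt_top hF hfin] with t ht hlt
    have h1 : Tendsto (fun n : ℕ => c * ((n : ℝ) - β) * t) atTop atTop :=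
      ((tendsto_atTop_add_const_right _ _ tendsto_natCast_atTop_atTop).const_mul_atTop
        hc).atTop_mul_const ht
    have h2 := ENNReal.tendsto_ofReal (Real.tendsto_exp_neg_atTop_nhds_zero.comp h1)
    rw [ENNReal.ofReal_zero] at h2
    have h3 := ENNReal.Tendsto.const_mul (a := F t) h2 (Or.inr hlt.ne)
    rw [mul_zero] at h3
    exact h3

lemma zero_le_aux {α m : ℝ} (n : ℕ) (hm : 0 < m) (hmn : m ≤ n) (f : ℝ → ℝ) (R : ℝ) {p : ℝ}
    (hp : 1 ≤ p) :
    ∫⁻ x in Set.Ioc 0 R, ‖Ac α m 0 f * psi n 0 x‖ₑ ^ p ≤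
      ‖Ac α m 0 f‖ₑ ^ p * ENNReal.ofReal (1 / m) := by
  have hn : (0 : ℝ) < n := by linarith
  have hn0 : 0 < n := by exact_mod_cast hn
  calc _ ≤ ∫⁻ x in Set.Ioi (0 : ℝ), ‖Ac α m 0 f‖ₑ ^ p * ENNReal.ofReal (psi n 0 x) := by
        refine (lintegral_mono_set Set.Ioc_subset_Ioi_self).trans ?_
        refine setLIntegral_mono' measurableSet_Ioi fun x hx => ?_
        rw [enorm_mul, ENNReal.mul_rpow_of_nonneg _ _ (by linarith),
          Real.enorm_of_nonneg (psi_nonneg n 0 (le_of_lt hx))]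
        gcongr
        refine ENNReal.rpow_le_self_of_le_one ?_ hp
        rw [ENNReal.ofReal_le_one]
        simp only [psi, pow_zero, Nat.factorial_zero, Nat.cast_one, mul_one, div_one]
        rw [Real.exp_le_one_iff]
        have : 0 < n * x := mul_pos hn hx
        linarith
    _ = ‖Ac α m 0 f‖ₑ ^ p * ENNReal.ofReal (1 / n) := by
        rw [lintegral_const_mul _ (psi_measurable _ _).ennreal_ofReal, psi_lintegral _ _ hn0]
    _ ≤ _ := by
        gcongr

lemma Ac0_le1 {α m : ℝ} (hα : 0 < α + 1) (hm : 0 < m) {f : ℝ → ℝ} (hf : Measurable f) :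
    ‖Ac α m 0 f‖ₑ ≤ ENNReal.ofReal (m ^ (α + 1) / Real.Gamma (α + 1)) *
      ∫⁻ t in Set.Ioi (0 : ℝ), ‖f t * t ^ α‖ₑ * ENNReal.ofReal (Real.exp (-(m * t))) := by
  unfold Ac
  refine (enorm_integral_le_lintegral_enorm _).trans ?_
  rw [← lintegral_const_mul _ (by fun_prop)]
  refine setLIntegral_mono' measurableSet_Ioi fun t ht => ?_
  have := Real.Gamma_pos_of_pos hα
  rw [← Real.enorm_of_nonneg (by positivity), ← Real.enorm_of_nonneg (Real.exp_pos _).le,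
    ← enorm_mul, ← enorm_mul]
  apply le_of_eq
  congr 1
  simp only [gam, Nat.cast_zero, zero_add, add_sub_cancel_right]
  ring

lemma Ac0_junk {α m : ℝ} (hα : 0 < α + 1) (hm : 0 < m) {f : ℝ → ℝ} (hf : Measurable f)
    {R : ℝ} (hv : ∀ t : ℝ, R < t → f t = 0)
    (hni : ¬ IntegrableOn (fun t => f t * t ^ α) (Set.Ioi 0)) : Ac α m 0 f = 0 := by
  unfold Ac
  refine integral_undef fun hi => hni ?_
  have hG := Real.Gamma_pos_of_pos hα
  have h1 := hi.norm.const_mul (Real.Gamma (α + 1) / m ^ (α + 1) * Real.exp (m * R))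
  refine Integrable.mono' h1 (by fun_prop) ?_
  filter_upwards [ae_restrict_mem measurableSet_Ioi] with t ht
  have ht0 : 0 < t := ht
  by_cases htR : R < t
  · simp [hv t htR]
  · have hmp := Real.rpow_pos_of_pos hm (α + 1)
    have hta := Real.rpow_pos_of_pos ht0 α
    simp only [gam, Nat.cast_zero, zero_add, add_sub_cancel_right, norm_mul]
    rw [Real.norm_of_nonneg (Real.exp_pos _).le, Real.norm_of_nonneg (by positivity : 0 ≤ m ^ (α + 1) / Real.Gamma (α + 1))]
    have e1 : 1 ≤ Real.exp (m * R) * Real.exp (-(m * t)) := by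
      rw [← Real.exp_add, Real.one_le_exp_iff]
      nlinarith
    calc ‖f t‖ * ‖t ^ α‖ ≤ ‖f t‖ * ‖t ^ α‖ * (Real.exp (m * R) * Real.exp (-(m * t))) :=
          le_mul_of_one_le_right (by positivity) e1
      _ = _ := by field_simp

lemma Ac0_le2 {α m p q : ℝ} (hα : 0 < α + 1) (hm : 0 < m) {f : ℝ → ℝ} (hf : Measurable f)
    (hpq : p.HolderConjugate q) (hq : -1 < α * q) :
    ‖Ac α m 0 f‖ₑ ^ p * ENNReal.ofReal (1 / m) ≤
      ENNReal.ofReal (((1 / Real.Gamma (α + 1)) ^ q * ((2 / q) ^ (α * q + 1) * Real.Gamma (α * q + 1))) ^ (p / q)) *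
      ∫⁻ t in Set.Ioi (0 : ℝ), ‖f t‖ₑ ^ p * ENNReal.ofReal (Real.exp (-(p / 2 * m * t))) := by
  have hp0 := hpq.pos
  have hq0 := hpq.symm.pos
  have hG := Real.Gamma_pos_of_pos hα
  have hG2 := Real.Gamma_pos_of_pos (show 0 < α * q + 1 by linarith)
  have h1 : ‖Ac α m 0 f‖ₑ ≤ ∫⁻ t in Set.Ioi (0 : ℝ),
      ((fun t => ‖f t‖ₑ * ENNReal.ofReal (Real.exp (-(m / 2 * t)))) *
      (fun t => ENNReal.ofReal (m ^ (α + 1) / Real.Gamma (α + 1) * t ^ α * Real.exp (-(m / 2 * t))))) t := by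
    unfold Ac
    refine (enorm_integral_le_lintegral_enorm _).trans ?_
    refine setLIntegral_mono' measurableSet_Ioi fun t ht => ?_
    have ht0 : 0 < t := ht
    have hta := Real.rpow_pos_of_pos ht0 α
    simp only [Pi.mul_apply]
    rw [← Real.enorm_of_nonneg (by positivity), ← Real.enorm_of_nonneg (by positivity),
      ← enorm_mul, ← enorm_mul]
    apply le_of_eq
    congr 1
    simp only [gam, Nat.cast_zero, zero_add, add_sub_cancel_right]
    have : Real.exp (-(m * t)) = Real.exp (-(m / 2 * t)) * Real.exp (-(m / 2 * t)) := by
      rw [← Real.exp_add]; congr 1; ring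
    rw [this]
    ring
  have h2 := h1.trans (ENNReal.lintegral_mul_le_Lp_mul_Lq _ hpq
    (by fun_prop) (by fun_prop))
  have h3 : ∫⁻ t in Set.Ioi (0 : ℝ), (ENNReal.ofReal (m ^ (α + 1) / Real.Gamma (α + 1) * t ^ α *
      Real.exp (-(m / 2 * t)))) ^ q =
      ENNReal.ofReal (((1 / Real.Gamma (α + 1)) ^ q * ((2 / q) ^ (α * q + 1) * Real.Gamma (α * q + 1)))
        * m ^ (q - 1)) := by
    have hi0 := integrableOn_rpow_mul_exp_neg_mul_rpow (p := 1) (s := α * q) (b := q * m / 2) hq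
      one_pos (by positivity)
    have hval := Real.integral_rpow_mul_exp_neg_mul_Ioi (a := α * q + 1) (r := q * m / 2)
      (by linarith) (by positivity)
    have hi : IntegrableOn (fun t : ℝ => t ^ (α * q + 1 - 1) * Real.exp (-(q * m / 2 * t))) (Set.Ioi 0) := by
      simpa [neg_mul] using hi0
    have hi2 := hi.const_mul ((m ^ (α + 1) / Real.Gamma (α + 1)) ^ q)
    have h4 := ofReal_integral_eq_lintegral_ofReal hi2 (by
      filter_upwards [ae_restrict_mem measurableSet_Ioi] with t ht
      have ht0 : 0 < t := ht
      simp only [Pi.zero_apply]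
      positivity)
    rw [integral_const_mul, hval] at h4
    have h5 : ∫⁻ t in Set.Ioi (0 : ℝ), (ENNReal.ofReal (m ^ (α + 1) / Real.Gamma (α + 1) * t ^ α *
      Real.exp (-(m / 2 * t)))) ^ q = ∫⁻ t in Set.Ioi (0 : ℝ), ENNReal.ofReal
        ((m ^ (α + 1) / Real.Gamma (α + 1)) ^ q * (t ^ (α * q + 1 - 1) * Real.exp (-(q * m / 2 * t)))) := by
      refine setLIntegral_congr_fun measurableSet_Ioi fun t ht => ?_
      have ht0 : 0 < t := ht
      have hta := Real.rpow_pos_of_pos ht0 α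
      rw [ENNReal.ofReal_rpow_of_nonneg (by positivity) hq0.le, Real.mul_rpow (by positivity) (by positivity),
        Real.mul_rpow (by positivity) (by positivity), ← Real.rpow_mul ht0.le, ← Real.exp_mul,
        add_sub_cancel_right, mul_assoc]
      ring_nf
    rw [h5, ← h4]
    congr 1
    rw [div_eq_mul_one_div (m ^ (α + 1)), Real.mul_rpow (by positivity) (by positivity),
      ← Real.rpow_mul hm.le, show 1 / (q * m / 2) = (2 / q) * m⁻¹ by field_simp,
      Real.mul_rpow (by positivity) (by positivity), Real.inv_rpow hm.le,
      ← Real.rpow_neg hm.le, show q - 1 = (α + 1) * q + -(α * q + 1) by ring, Real.rpow_add hm]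
    ring
  have h6 : ∫⁻ t in Set.Ioi (0 : ℝ), (‖f t‖ₑ * ENNReal.ofReal (Real.exp (-(m / 2 * t)))) ^ p =
      ∫⁻ t in Set.Ioi (0 : ℝ), ‖f t‖ₑ ^ p * ENNReal.ofReal (Real.exp (-(p / 2 * m * t))) := by
    refine lintegral_congr fun t => ?_
    rw [ENNReal.mul_rpow_of_nonneg _ _ hp0.le, ENNReal.ofReal_rpow_of_nonneg (Real.exp_pos _).le hp0.le,
      ← Real.exp_mul]
    ring_nf
  rw [h3, h6] at h2
  have h7 := ENNReal.rpow_le_rpow h2 hp0.le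
  rw [ENNReal.mul_rpow_of_nonneg _ _ hp0.le, ← ENNReal.rpow_mul, one_div_mul_cancel hp0.ne',
    ENNReal.rpow_one, ← ENNReal.rpow_mul, ENNReal.ofReal_rpow_of_nonneg (by positivity) (by positivity)] at h7
  refine (mul_le_mul_left h7 _).trans ?_
  rw [mul_comm (∫⁻ t in Set.Ioi (0 : ℝ), _), mul_right_comm, ← ENNReal.ofReal_mul (by positivity)]
  apply le_of_eq
  congr 2
  rw [Real.mul_rpow (by positivity) (by positivity), ← Real.rpow_mul hm.le,
    show (q - 1) * (1 / q * p) = 1 by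
      have := hpq.sub_one_mul_conj
      have := hpq.symm.sub_one_mul_conj
      field_simp; linarith, Real.rpow_one, show 1 / q * p = p / q by ring]
  field_simp

lemma zero_tendsto {α : ℝ} (hα : 0 < α + 1) (hα0 : α ≤ 0) (β : ℝ) (hβ : 0 ≤ β) {f : ℝ → ℝ} (hf : Measurable f) {R : ℝ}
    (hv : ∀ t : ℝ, R < t → f t = 0) {p : ℝ} (hp : 1 ≤ p)
    (hfin : ∫⁻ t in Set.Ioi (0 : ℝ), ‖f t‖ₑ ^ p ≠ ⊤) :
    Tendsto (fun n : ℕ => ∫⁻ x in Set.Ioc 0 R, ‖Ac α (n - β) 0 f * psi n 0 x‖ₑ ^ p) atTop (nhds 0) := by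
  have hp0 : 0 < p := by linarith
  have hG := Real.Gamma_pos_of_pos hα
  suffices h : Tendsto (fun n : ℕ => ‖Ac α (n - β) 0 f‖ₑ ^ p * ENNReal.ofReal (1 / (n - β)))
      atTop (nhds 0) by
    refine tendsto_of_tendsto_of_tendsto_of_le_of_le' tendsto_const_nhds h
      (Eventually.of_forall fun _ => zero_le) ?_
    filter_upwards [ev_gt β] with n hn
    exact zero_le_aux n (sub_pos.2 hn) (by linarith) f R hp
  by_cases hcase : (α + 1) * p ≤ 1
  · by_cases hi : IntegrableOn (fun t => f t * t ^ α) (Set.Ioi 0)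
    · have h1 := dct_exp β one_pos (F := fun t => ‖f t * t ^ α‖ₑ) (by fun_prop) hi.2.ne
      have h2 := ENNReal.Tendsto.const_mul (a := ENNReal.ofReal (1 / Real.Gamma (α + 1))) h1
        (Or.inr ENNReal.ofReal_ne_top)
      rw [mul_zero] at h2
      have h3 := ((ENNReal.continuous_rpow_const (y := p)).tendsto _).comp h2
      rw [ENNReal.zero_rpow_of_pos hp0] at h3
      refine tendsto_of_tendsto_of_tendsto_of_le_of_le' tendsto_const_nhds h3
        (Eventually.of_forall fun _ => zero_le) ?_
      filter_upwards [ev_gt (β + 1)] with n hn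
      have hm1 : 1 ≤ (n : ℝ) - β := by linarith
      have hm : 0 < (n : ℝ) - β := by linarith
      have h4 := ENNReal.rpow_le_rpow (Ac0_le1 (m := n - β) hα hm hf) hp0.le
      refine (mul_le_mul_left h4 _).trans ?_
      simp only [Function.comp_apply, one_mul]
      rw [ENNReal.mul_rpow_of_nonneg _ _ hp0.le, ENNReal.mul_rpow_of_nonneg _ _ hp0.le, mul_right_comm]
      gcongr
      rw [ENNReal.ofReal_rpow_of_nonneg (by positivity) hp0.le,
        ENNReal.ofReal_rpow_of_nonneg (by positivity) hp0.le, ← ENNReal.ofReal_mul (by positivity)]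
      apply ENNReal.ofReal_le_ofReal
      rw [div_eq_mul_one_div (((n : ℝ) - β) ^ (α + 1)), Real.mul_rpow (by positivity) (by positivity),
        ← Real.rpow_mul hm.le]
      have h5 : ((n : ℝ) - β) ^ ((α + 1) * p) ≤ n - β := by
        calc _ ≤ ((n : ℝ) - β) ^ (1 : ℝ) := Real.rpow_le_rpow_of_exponent_le hm1 hcase
          _ = _ := Real.rpow_one _
      have h6 : ((n : ℝ) - β) ^ ((α + 1) * p) * (1 / (n - β)) ≤ 1 := by
        rw [mul_one_div, div_le_one hm]; exact h5
      have h7 : 0 ≤ (1 / Real.Gamma (α + 1)) ^ p := by positivity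
      nlinarith [mul_le_mul_of_nonneg_left h6 h7]
    · refine tendsto_const_nhds.congr' ?_
      filter_upwards [ev_gt β] with n hn
      rw [Ac0_junk hα (sub_pos.2 hn) hf hv hi]
      simp [hp0]
  · push Not at hcase
    have hp1 : 1 < p := by nlinarith
    have hpq := Real.HolderConjugate.conjExponent hp1
    set q := p.conjExponent with hq
    have hq1 : -1 < α * q := by
      have h1 : q = p / (p - 1) := rfl
      rw [h1, mul_div_assoc', lt_div_iff₀ (by linarith)]
      nlinarith
    have h1 := dct_exp β (c := p / 2) (by positivity) (F := fun t => ‖f t‖ₑ ^ p) (by fun_prop) hfin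
    have h2 := ENNReal.Tendsto.const_mul (a := ENNReal.ofReal (((1 / Real.Gamma (α + 1)) ^ q * ((2 / q) ^ (α * q + 1) * Real.Gamma (α * q + 1))) ^ (p / q))) h1
      (Or.inr ENNReal.ofReal_ne_top)
    rw [mul_zero] at h2
    refine tendsto_of_tendsto_of_tendsto_of_le_of_le' tendsto_const_nhds h2
      (Eventually.of_forall fun _ => zero_le) ?_
    filter_upwards [ev_gt β] with n hn
    exact Ac0_le2 hα (sub_pos.2 hn) hf hpq hq1

/-- Local `L_p`-convergence on `[0,R]`. -/
theorem stmt_17 (p : ℝ) (hp : 1 ≤ p) (α : ℝ) (hα : α ∈ Set.Icc (-(1 : ℝ) / 2) 0)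
    (β : ℝ) (hβ : 0 ≤ β) (R : ℝ) (hR : 0 < R) (f : ℝ → ℝ) (hf : Measurable f)
    (hvanish : ∀ t : ℝ, R < t → f t = 0)
    (hint : IntegrableOn (fun t => |f t| ^ p) (Set.Ioc 0 R)) :
    ∀ ε > (0 : ℝ), ∃ N : ℕ, ∀ n : ℕ, N ≤ n → β < n →
      (∫ x in Set.Ioc (0 : ℝ) R, |M α β n f x - f x| ^ p) < ε := by
  have hα1 : 0 < α + 1 := by linarith [hα.1]
  have hα0 : α ≤ 0 := hα.2
  have hp0 : 0 < p := by linarith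
  set P := ENNReal.ofReal p with hP
  have hP0 : P ≠ 0 := by simpa [hP] using hp0
  have hPt : P ≠ ⊤ := ENNReal.ofReal_ne_top
  have hPr : P.toReal = p := ENNReal.toReal_ofReal hp0.le
  have hP1 : 1 ≤ P := by simpa [hP] using hp
  set F : ℝ → ℝ := (Set.Ioc 0 R).indicator f with hF
  have hFf : ∀ t, 0 < t → F t = f t := by
    intro t ht
    by_cases h : t ≤ R
    · exact Set.indicator_of_mem (show t ∈ Set.Ioc 0 R from ⟨ht, h⟩) f
    · rw [hF, Set.indicator_of_notMem (fun h' => h h'.2), hvanish t (not_le.1 h)]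
  have hmem0 : MemLp f P (volume.restrict (Set.Ioc 0 R)) := by
    rw [← integrable_norm_rpow_iff hf.aestronglyMeasurable hP0 hPt, hPr]
    exact hint
  have hmemF : MemLp F P volume := by
    rw [hF, memLp_indicator_iff_restrict measurableSet_Ioc]
    exact hmem0
  have hfF : f =ᵐ[volume.restrict (Set.Ioi 0)] F := by
    filter_upwards [ae_restrict_mem measurableSet_Ioi] with t ht
    exact (hFf t ht).symm
  have hfi : IntegrableOn f (Set.Ioi 0) := by
    have h1 : Integrable f (volume.restrict (Set.Ioc 0 R)) :=
      memLp_one_iff_integrable.1 (hmem0.mono_exponent hP1)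
    have h2 : Integrable F := (integrable_indicator_iff measurableSet_Ioc).2 h1
    exact h2.integrableOn.congr hfF.symm
  have hfin : ∫⁻ t in Set.Ioi (0 : ℝ), ‖f t‖ₑ ^ p ≠ ⊤ := by
    have h1 := lintegral_rpow_enorm_lt_top_of_eLpNorm_lt_top hP0 hPt
      ((memLp_congr_ae hfF).2 (hmemF.restrict _)).2
    rw [hPr] at h1
    exact h1.ne
  intro ε hε
  set η : ℝ := (ε / 2) ^ (1 / p) / 4 with hη
  have hη0 : 0 < η := by positivity
  set δ := ENNReal.ofReal η with hδ
  have hδ0 : δ ≠ 0 := by simpa [hδ] using hη0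
  obtain ⟨g, hgc, hgF, hgcont, hgm⟩ := hmemF.exists_hasCompactSupport_eLpNorm_sub_le hPt hδ0
  obtain ⟨B, hB⟩ := hgc.exists_bound_of_continuous hgcont
  have hgi : IntegrableOn g (Set.Ioi 0) := (hgcont.integrable_of_hasCompactSupport hgc).integrableOn
  have hδp : 0 < δ ^ p := ENNReal.rpow_pos (pos_iff_ne_zero.2 hδ0) ENNReal.ofReal_ne_top
  have toE : ∀ h : ℝ → ℝ, (∫⁻ x in Set.Ioc 0 R, ‖h x‖ₑ ^ p) ≤ δ ^ p →
      eLpNorm h P (volume.restrict (Set.Ioc 0 R)) ≤ δ := by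
    intro h hh
    rw [eLpNorm_eq_lintegral_rpow_enorm_toReal hP0 hPt, hPr]
    have := ENNReal.rpow_le_rpow hh (by positivity : 0 ≤ 1 / p)
    rwa [← ENNReal.rpow_mul, mul_one_div_cancel hp0.ne', ENNReal.rpow_one] at this
  have hfg : ∫⁻ t in Set.Ioi (0 : ℝ), ‖(f - g) t‖ₑ ^ p ≤ δ ^ p := by
    have h1 : eLpNorm (f - g) P (volume.restrict (Set.Ioi 0)) ≤ δ := by
      rw [eLpNorm_congr_ae (hfF.sub (ae_eq_refl g))]
      exact (eLpNorm_mono_measure _ Measure.restrict_le_self).trans hgF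
    rw [eLpNorm_eq_lintegral_rpow_enorm_toReal hP0 hPt, hPr] at h1
    have := ENNReal.rpow_le_rpow h1 hp0.le
    rwa [← ENNReal.rpow_mul, one_div_mul_cancel hp0.ne', ENNReal.rpow_one] at this
  have ev1 := (zero_tendsto hα1 hα0 β hβ hf hvanish hp hfin).eventually_lt_const hδp
  have ev2 := (Sop_Lp_tendsto hα1 β hgi hgcont hB R hp).eventually_lt_const hδp
  obtain ⟨N, hN⟩ := eventually_atTop.1 (ev1.and ev2)
  refine ⟨N, fun n hn hβn => ?_⟩
  obtain ⟨h1, h2⟩ := hN n hn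
  have hm : 0 < (n : ℝ) - β := sub_pos.2 hβn
  have hmn : (n : ℝ) - β ≤ n := by linarith
  have b1 := toE _ h1.le
  have b2 := toE _ h2.le
  have b3 := toE (Sop α (n - β) n (f - g)) (((lintegral_mono_set Set.Ioc_subset_Ioi_self).trans
    (Sop_contr hα1 hm n hmn (hf.sub hgcont.measurable) hp)).trans hfg)
  have b4 := toE (f - g) ((lintegral_mono_set Set.Ioc_subset_Ioi_self).trans hfg)
  have hM : (fun x => M α β n f x - f x) =ᵐ[volume.restrict (Set.Ioc 0 R)]
      ((fun x => Ac α (n - β) 0 f * psi n 0 x) + Sop α (n - β) n (f - g)) +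
        ((fun x => Sop α (n - β) n g x - g x) - (f - g)) := by
    filter_upwards [ae_restrict_mem measurableSet_Ioc] with x hx
    simp only [Pi.add_apply, Pi.sub_apply]
    rw [M_eq hα1 n hβn hfi hx.1.le, Sop_sub hα1 hm n hfi hgi hx.1.le]
    ring
  have m1 : Measurable (fun x => Ac α (n - β) 0 f * psi n 0 x) := (psi_measurable n 0).const_mul _
  have m2 : Measurable (Sop α (n - β) n (f - g)) := Sop_measurable _ _ _ _
  have m3 : Measurable (fun x => Sop α (n - β) n g x - g x) :=
    (Sop_measurable _ _ _ _).sub hgcont.measurable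
  have m4 : Measurable (f - g) := hf.sub hgcont.measurable
  have hE : eLpNorm (fun x => M α β n f x - f x) P (volume.restrict (Set.Ioc 0 R)) ≤
      (δ + δ) + (δ + δ) := by
    rw [eLpNorm_congr_ae hM]
    refine (eLpNorm_add_le (m1.add m2).aestronglyMeasurable (m3.sub m4).aestronglyMeasurable hP1).trans ?_
    refine add_le_add ?_ ?_
    · exact (eLpNorm_add_le m1.aestronglyMeasurable m2.aestronglyMeasurable hP1).trans
        (add_le_add b1 b3)
    · exact (eLpNorm_sub_le m3.aestronglyMeasurable m4.aestronglyMeasurable hP1).trans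
        (add_le_add b2 b4)
  have hfinal : ∫⁻ x in Set.Ioc 0 R, ‖M α β n f x - f x‖ₑ ^ p ≤ ENNReal.ofReal (ε / 2) := by
    rw [eLpNorm_eq_lintegral_rpow_enorm_toReal hP0 hPt, hPr] at hE
    have h5 := ENNReal.rpow_le_rpow hE hp0.le
    rw [← ENNReal.rpow_mul, one_div_mul_cancel hp0.ne', ENNReal.rpow_one] at h5
    refine h5.trans (le_of_eq ?_)
    rw [hδ, ← ENNReal.ofReal_add hη0.le hη0.le, ← ENNReal.ofReal_add (by positivity) (by positivity),
      ENNReal.ofReal_rpow_of_nonneg (by positivity) hp0.le]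
    congr 1
    rw [show η + η + (η + η) = (ε / 2) ^ (1 / p) by rw [hη]; ring, ← Real.rpow_mul (by positivity),
      one_div_mul_cancel hp0.ne', Real.rpow_one]
  have h6 := norm_integral_le_lintegral_norm (μ := volume.restrict (Set.Ioc 0 R))
    (fun x => |M α β n f x - f x| ^ p)
  have h7 : ∫⁻ x in Set.Ioc 0 R, ENNReal.ofReal ‖|M α β n f x - f x| ^ p‖ =
      ∫⁻ x in Set.Ioc 0 R, ‖M α β n f x - f x‖ₑ ^ p := by
    refine lintegral_congr fun x => ?_
    rw [Real.norm_of_nonneg (by positivity), ← ENNReal.ofReal_rpow_of_nonneg (abs_nonneg _) hp0.le,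
      ← Real.norm_eq_abs, ofReal_norm]
  rw [h7] at h6
  calc _ ≤ ‖∫ x in Set.Ioc (0 : ℝ) R, |M α β n f x - f x| ^ p‖ := Real.le_norm_self _
    _ ≤ _ := h6
    _ ≤ (ENNReal.ofReal (ε / 2)).toReal := ENNReal.toReal_mono ENNReal.ofReal_ne_top hfinal
    _ = ε / 2 := ENNReal.toReal_ofReal (by positivity)
    _ < ε := by linarith
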